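/- Let m < 0 and a ≠ 0 be real constants. For every ε > 0 there exists a smooth compactly supported function G : ℝ → ℝ with sup-norm strictly less than ε (and F ≡ 0) such that the solution (q, θ) of the system q'(t) = sin(θ(t)), θ'(t) = (a/(2m))·G(q(t)−t)·cos²(θ(t)) − (a²/(2m))·sin(θ(t)) with q(0) = 0, θ(0) = 0 reaches the speed of light in finite time: there exists T > 0 with |θ(T)| = π/2, i.e., |q'(T)| = |sin(θ(T))| = 1. -/

import Mathlib

open Filter in
/-- If `f` is smooth with `|f| ≤ 1/2`, then `t ↦ t - ∫₀ᵗ f` is an increasing diffeomorphism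
of the line. -/
theorem exists_homeomorph_id_sub_integral {f : ℝ → ℝ} (hf : ContDiff ℝ (⊤ : ℕ∞) f)
    (hb : ∀ t, |f t| ≤ 1 / 2) :
    ∃ e : ℝ ≃ₜ ℝ, (∀ t, e t = t - ∫ x in (0 : ℝ)..t, f x) ∧
      ContDiff ℝ (⊤ : ℕ∞) e.symm ∧ StrictMono e := by
  have hd : ∀ t, HasDerivAt (fun t => t - ∫ x in (0 : ℝ)..t, f x) (1 - f t) t := fun t =>
    (hasDerivAt_id t).sub (hf.continuous.integral_hasStrictDerivAt 0 t).hasDerivAt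
  have hsmooth : ContDiff ℝ (⊤ : ℕ∞) (fun t => t - ∫ x in (0 : ℝ)..t, f x) := by
    rw [contDiff_infty_iff_deriv]
    refine ⟨fun t => (hd t).differentiableAt, ?_⟩
    rw [show deriv (fun t => t - ∫ x in (0 : ℝ)..t, f x) = fun t => 1 - f t from
      funext fun t => (hd t).deriv]
    exact contDiff_const.sub hf
  have hpos : ∀ t, 0 < 1 - f t := fun t => by linarith [le_of_abs_le (hb t)]
  have hmono : StrictMono (fun t => t - ∫ x in (0 : ℝ)..t, f x) :=
    strictMono_of_deriv_pos fun t => by rw [(hd t).deriv]; exact hpos t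
  have hint : ∀ t, |∫ x in (0 : ℝ)..t, f x| ≤ 1 / 2 * |t| := fun t => by
    simpa using intervalIntegral.norm_integral_le_of_norm_le_const (f := f) (a := 0) (b := t)
      (C := 1 / 2) (fun x _ => hb x)
  have htop : Tendsto (fun t => t - ∫ x in (0 : ℝ)..t, f x) atTop atTop := by
    refine tendsto_atTop_mono' atTop ?_ (tendsto_id.atTop_mul_const (r := (1 / 2 : ℝ)) (by norm_num))
    filter_upwards [eventually_ge_atTop 0] with t ht
    have := le_of_abs_le (hint t)
    rw [abs_of_nonneg ht] at this
    simp only [id]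
    linarith
  have hbot : Tendsto (fun t => t - ∫ x in (0 : ℝ)..t, f x) atBot atBot := by
    refine tendsto_atBot_mono' atBot ?_ (tendsto_id.atBot_mul_const (r := (1 / 2 : ℝ)) (by norm_num))
    filter_upwards [eventually_le_atBot 0] with t ht
    have := neg_le_of_abs_le (hint t)
    rw [abs_of_nonpos ht] at this
    simp only [id]
    linarith
  let e : ℝ ≃ₜ ℝ := (hmono.orderIsoOfSurjective _
    (hsmooth.continuous.surjective htop hbot)).toHomeomorph
  exact ⟨e, fun t => rfl,
    e.contDiff_symm_deriv (f' := fun t => 1 - f t) (fun t => (hpos t).ne') hd hsmooth, hmono⟩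

theorem Real.deriv_smoothTransition_of_nonpos {t : ℝ} (ht : t ≤ 0) :
    deriv smoothTransition t = 0 := by
  refine IsLocalMin.deriv_eq_zero (Filter.Eventually.of_forall fun x => ?_)
  rw [smoothTransition.zero_of_nonpos ht]
  exact smoothTransition.nonneg x

theorem Real.deriv_smoothTransition_of_one_le {t : ℝ} (ht : 1 ≤ t) :
    deriv smoothTransition t = 0 := by
  refine IsLocalMax.deriv_eq_zero (Filter.Eventually.of_forall fun x => ?_)
  rw [smoothTransition.one_of_one_le ht]
  exact smoothTransition.le_one x

theorem Real.sin_two_mul_arctan (x : ℝ) : sin (2 * arctan x) = 2 * x / (1 + x ^ 2) := by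
  rw [sin_two_mul, mul_assoc, ← tan_mul_cos (cos_arctan_pos x).ne', tan_arctan, mul_assoc, ← sq,
    cos_sq_arctan]
  ring

theorem Real.cos_two_mul_arctan (x : ℝ) : cos (2 * arctan x) = (1 - x ^ 2) / (1 + x ^ 2) := by
  have : 1 + x ^ 2 ≠ 0 := by positivity
  rw [cos_two_mul, cos_sq_arctan]
  field_simp
  ring

open Real

/-- Instability for negative bare mass: for every `ε > 0` there is a smooth,
compactly supported incoming radiation profile `G` with sup-norm `< ε`
(and `F ≡ 0`) such that the solution of
`q' = sin θ`, `θ' = (a/(2m)) G(q−t) cos²θ − (a²/(2m)) sin θ`,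
`q(0) = 0`, `θ(0) = 0`, reaches the speed of light in finite time. -/
theorem instability_negative_bare_mass
    (m a : ℝ) (hm : m < 0) (ha : a ≠ 0) :
    ∀ ε > (0 : ℝ),
      ∃ G : ℝ → ℝ, ContDiff ℝ (⊤ : ℕ∞) G ∧ HasCompactSupport G ∧ (∀ x, |G x| < ε) ∧
        ∃ q θ : ℝ → ℝ, ∃ T > (0 : ℝ),
          q 0 = 0 ∧ θ 0 = 0 ∧
          (∀ t ∈ Set.Icc (0 : ℝ) T,
            HasDerivAt q (sin (θ t)) t ∧
            HasDerivAt θ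
              ((a / (2 * m)) * G (q t - t) * cos (θ t) ^ 2
                - (a ^ 2 / (2 * m)) * sin (θ t)) t) ∧
          |θ T| = π / 2 ∧ |sin (θ T)| = 1 := by
  intro ε hε
  set c := a / (2 * m) with hc
  set d := a ^ 2 / (2 * m) with hd
  have hc0 : c ≠ 0 := div_ne_zero ha (by linarith)
  obtain ⟨b, hb, hbd⟩ : ∃ b > 0, d = -b :=
    ⟨-d, neg_pos.2 (div_neg_of_pos_of_neg (by positivity) (by linarith)), (neg_neg d).symm⟩
  rw [hbd]
  have hη : ContDiff ℝ (⊤ : ℕ∞) smoothTransition := smoothTransition.contDiff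
  have hη' : ContDiff ℝ (⊤ : ℕ∞) (deriv smoothTransition) := (contDiff_infty_iff_deriv.1 hη).2
  set k : ℝ → ℝ := fun t => deriv smoothTransition t * exp (b * t) with hk
  have hks : ContDiff ℝ (⊤ : ℕ∞) k := hη'.mul (contDiff_const.mul contDiff_id).exp
  have hk0 : ∀ t ≤ 0, k t = 0 := fun t ht => by
    simp [hk, deriv_smoothTransition_of_nonpos ht]
  have hk1 : ∀ t, 1 ≤ t → k t = 0 := fun t ht => by
    simp [hk, deriv_smoothTransition_of_one_le ht]
  have hk_out : ∀ t, t ∉ Set.Icc (0 : ℝ) 1 → k t = 0 := fun t ht => by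
    by_contra h
    exact ht ⟨le_of_lt (not_le.1 fun h' => h (hk0 t h')),
      le_of_lt (not_le.1 fun h' => h (hk1 t h'))⟩
  obtain ⟨K, hK⟩ := (HasCompactSupport.intro isCompact_Icc hk_out).exists_bound_of_continuous
    hks.continuous
  have hK0 : 0 ≤ K := (norm_nonneg _).trans (hK 0)
  obtain ⟨δ, hδ0, hδ1, hδ2⟩ : ∃ δ > 0, δ * exp (b * 2) ≤ 1 / 4 ∧ 6 * δ * K < ε * |c| := by
    have hεc : 0 < ε * |c| := mul_pos hε (abs_pos.2 hc0)
    refine ⟨min (1 / 4 / exp (b * 2)) (ε * |c| / (6 * (K + 1))), by positivity, ?_, ?_⟩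
    · rw [← le_div_iff₀ (exp_pos _)]
      exact min_le_left _ _
    · have h := min_le_right (1 / 4 / exp (b * 2)) (ε * |c| / (6 * (K + 1)))
      have hpos : 0 < min (1 / 4 / exp (b * 2)) (ε * |c| / (6 * (K + 1))) := by positivity
      rw [le_div_iff₀ (by positivity)] at h
      linarith
  set u : ℝ → ℝ := fun t => δ * (smoothTransition t * exp (b * t)) with hu
  set v : ℝ → ℝ := fun t => u t * (1 - smoothTransition (t - 1)) with hv
  have hus : ContDiff ℝ (⊤ : ℕ∞) u :=
    contDiff_const.mul (hη.mul (contDiff_const.mul contDiff_id).exp)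
  have hvs : ContDiff ℝ (⊤ : ℕ∞) v :=
    hus.mul (contDiff_const.sub (hη.comp (contDiff_id.sub contDiff_const)))
  have hu0 : ∀ t, 0 ≤ u t := fun t =>
    mul_nonneg hδ0.le (mul_nonneg (smoothTransition.nonneg t) (exp_pos _).le)
  have hv0 : ∀ t, 0 ≤ v t := fun t =>
    mul_nonneg (hu0 t) (sub_nonneg.2 (smoothTransition.le_one _))
  have hv1 : ∀ t, v t ≤ 1 / 4 := fun t => by
    rcases le_total t 2 with ht | ht
    · calc v t ≤ u t := mul_le_of_le_one_right (hu0 t)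
            (by linarith [smoothTransition.nonneg (t - 1)])
        _ ≤ δ * exp (b * 2) := mul_le_mul_of_nonneg_left
            ((mul_le_of_le_one_left (exp_pos _).le (smoothTransition.le_one t)).trans
              (exp_le_exp.2 (mul_le_mul_of_nonneg_left ht hb.le))) hδ0.le
        _ ≤ 1 / 4 := hδ1
    · simp only [hv, smoothTransition.one_of_one_le (show 1 ≤ t - 1 by linarith)]
      norm_num
  have huv : ∀ t ≤ 1, v t = u t := fun t ht => by
    simp [hv, smoothTransition.zero_of_nonpos (show t - 1 ≤ 0 by linarith)]
  have hsq : ∀ x : ℝ, 1 + x ^ 2 ≠ 0 := fun x => by positivity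
  have hsqv : ∀ t, 9 / 10 ≤ 1 - v t ^ 2 := fun t => by nlinarith [hv0 t, hv1 t]
  obtain ⟨e, he, hes, hem⟩ := exists_homeomorph_id_sub_integral
    (f := fun t => 2 * v t / (1 + v t ^ 2))
    ((contDiff_const.mul hvs).div (contDiff_const.add (hvs.pow 2)) fun t => hsq _)
    (fun t => by
      rw [abs_of_nonneg (div_nonneg (by linarith [hv0 t]) (by positivity)),
        div_le_iff₀ (by positivity)]
      nlinarith [hv0 t, hv1 t, sq_nonneg (v t)])
  set g : ℝ → ℝ := fun t => 2 * δ * k t * (1 + v t ^ 2) / (c * (1 - v t ^ 2) ^ 2) with hg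
  have hgs : ContDiff ℝ (⊤ : ℕ∞) g :=
    ((contDiff_const.mul hks).mul (contDiff_const.add (hvs.pow 2))).div
      (contDiff_const.mul ((contDiff_const.sub (hvs.pow 2)).pow 2))
      fun t => mul_ne_zero hc0 (pow_ne_zero 2 (by linarith [hsqv t]))
  have hg_out : ∀ t, k t = 0 → g t = 0 := fun t ht => by simp [hg, ht]
  have hgb : ∀ t, |g t| < ε := fun t => by
    have h1 := hsqv t
    have h2 : |1 + v t ^ 2| ≤ 11 / 10 := by
      rw [abs_of_pos (by positivity)]; linarith
    have h3 : 1 / 2 ≤ |(1 - v t ^ 2) ^ 2| := by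
      rw [abs_of_nonneg (by positivity)]; nlinarith
    have hcp : 0 < |c| := abs_pos.2 hc0
    simp only [hg]
    rw [abs_div, abs_mul, abs_mul _ (k t), abs_mul, abs_mul c, div_lt_iff₀ (mul_pos hcp (by linarith)),
      abs_of_pos hδ0, abs_two]
    calc 2 * δ * |k t| * |1 + v t ^ 2| ≤ 2 * δ * K * (11 / 10) := by
          gcongr
          exact hK t
      _ ≤ 6 * δ * K * (1 / 2) := by
          have : 0 ≤ δ * K := by positivity
          linarith
      _ < ε * |c| * (1 / 2) := by linarith
      _ ≤ ε * (|c| * |(1 - v t ^ 2) ^ 2|) := by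
          rw [mul_assoc]
          gcongr
  set q : ℝ → ℝ := fun t => ∫ x in (0 : ℝ)..t, 2 * u x / (1 + u x ^ 2) with hq
  have hqc : Continuous fun x => 2 * u x / (1 + u x ^ 2) :=
    (continuous_const.mul hus.continuous).div (continuous_const.add (hus.continuous.pow 2))
      fun t => hsq _
  have hqd : ∀ t, HasDerivAt q (2 * u t / (1 + u t ^ 2)) t := fun t =>
    (hqc.integral_hasStrictDerivAt 0 t).hasDerivAt
  have hqe : ∀ t, 0 ≤ t → t ≤ 1 → t - q t = e t := fun t ht ht1 => by
    rw [he, hq]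
    congr 1
    refine intervalIntegral.integral_congr fun x hx => ?_
    rw [Set.uIcc_of_le ht] at hx
    simp only [huv x (hx.2.trans ht1)]
  have hqm : Monotone fun t => t - q t :=
    monotone_of_hasDerivAt_nonneg (fun t => (hasDerivAt_id t).sub (hqd t)) fun t => by
      simp only [Pi.zero_apply, sub_nonneg]
      rw [div_le_one (by positivity)]
      nlinarith [sq_nonneg (u t - 1)]
  have hud : ∀ t, HasDerivAt u (δ * k t + b * u t) t := fun t => by
    have h1 := ((hη.differentiable (by simp)) t).hasDerivAt
    have h2 := ((hasDerivAt_id t).const_mul b).exp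
    refine ((h1.mul h2).const_mul δ).congr_deriv ?_
    simp only [hk, hu, id]
    ring
  refine ⟨fun y => g (e.symm (-y)), hgs.comp (hes.comp contDiff_neg),
    (HasCompactSupport.intro isCompact_Icc fun t ht => hg_out t (hk_out t ht)).comp_homeomorph
      ((Homeomorph.neg ℝ).trans e.symm), fun x => hgb _, q, fun t => 2 * arctan (u t),
    -log δ / b, ?_, ?_, ?_, ?_, ?_⟩
  · have : δ < 1 := by nlinarith [one_le_exp (show 0 ≤ b * 2 by linarith)]
    exact div_pos (neg_pos.2 (log_neg hδ0 this)) hb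
  · simp [hq]
  · simp [hu]
  · rintro t ⟨ht, -⟩
    simp only [sin_two_mul_arctan, cos_two_mul_arctan]
    refine ⟨hqd t, ?_⟩
    refine ((hud t).arctan.const_mul 2).congr_deriv ?_
    have hsqt := hsq (u t)
    rw [neg_sub]
    rcases le_total t 1 with ht1 | ht1
    · have hvt := hsqv t
      rw [hqe t ht ht1, e.symm_apply_apply]
      simp only [hg]
      rw [huv t ht1] at hvt ⊢
      have : 1 - u t ^ 2 ≠ 0 := by linarith
      field_simp
      ring
    · have h1 : 1 ≤ e.symm (t - q t) := by
        rw [← hem.le_iff_le, e.apply_symm_apply, ← hqe 1 zero_le_one le_rfl]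
        exact hqm ht1
      rw [hg_out _ (hk1 _ h1), hk1 t ht1]
      field_simp
      ring
  · have hT : 1 ≤ -log δ / b := by
      have h := log_le_log (by positivity) hδ1
      rw [log_mul hδ0.ne' (exp_pos _).ne', log_exp] at h
      have h4 : log (1 / 4) < 0 := log_neg (by norm_num) (by norm_num)
      rw [le_div_iff₀ hb]
      linarith
    have huT : u (-log δ / b) = 1 := by
      simp only [hu]
      rw [smoothTransition.one_of_one_le hT, mul_div_cancel₀ _ hb.ne', exp_neg, exp_log hδ0,
        one_mul, mul_inv_cancel₀ hδ0.ne']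
    simp only [huT, arctan_one, show 2 * (π / 4) = π / 2 by ring]
    exact ⟨abs_of_pos (by positivity), by simp⟩
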